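/- Let K be a nonempty compact Hausdorff topological space and let C(K, ℝ) be the space of real-valued continuous functions on K, with the cone of pointwise nonnegative functions and order unit the constant function 1 (a real AOU space whose order norm is the supremum norm). Then C(K, ℝ) is a nuclear real AOU space: for every real AOU space W, (C(K, ℝ) ⊗_ε W)⁺ = (C(K, ℝ) ⊗_π W)⁺. -/

import Mathlib

open TensorProduct

/-- A real AOU space structure on a real vector space `V`: a proper cone together with
an Archimedean order unit. -/
structure AOU (V : Type*) [AddCommGroup V] [Module ℝ V] where
  pos : Set V
  unit : V
  zero_mem : (0 : V) ∈ pos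
  add_mem : ∀ ⦃x y : V⦄, x ∈ pos → y ∈ pos → x + y ∈ pos
  smul_mem : ∀ ⦃r : ℝ⦄, 0 ≤ r → ∀ ⦃x : V⦄, x ∈ pos → r • x ∈ pos
  proper : ∀ x : V, x ∈ pos → -x ∈ pos → x = 0
  exists_orderUnit : ∀ v : V, ∃ r : ℝ, 0 < r ∧ r • unit - v ∈ pos
  arch : ∀ v : V, (∀ ε : ℝ, 0 < ε → ε • unit + v ∈ pos) → v ∈ pos

variable {V W : Type*} [AddCommGroup V] [Module ℝ V] [AddCommGroup W] [Module ℝ W]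

/-- A state on a real AOU space: a unital positive linear functional. -/
def IsState (A : AOU V) (f : V →ₗ[ℝ] ℝ) : Prop :=
  f A.unit = 1 ∧ ∀ v ∈ A.pos, 0 ≤ f v

/-- The tensor product functional `f ⊗ g` on `V ⊗ W`, with `(f ⊗ g)(v ⊗ w) = f v * g w`. -/
noncomputable def tensFun (f : V →ₗ[ℝ] ℝ) (g : W →ₗ[ℝ] ℝ) :
    TensorProduct ℝ V W →ₗ[ℝ] ℝ :=
  TensorProduct.lift (f.smulRight g)

/-- The injective cone `(V ⊗_ε W)⁺`. -/
def injCone (A : AOU V) (B : AOU W) : Set (TensorProduct ℝ V W) :=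
  {z | ∀ (f : V →ₗ[ℝ] ℝ) (g : W →ₗ[ℝ] ℝ), IsState A f → IsState B g → 0 ≤ tensFun f g z}

/-- The set `V⁺ ⊗ W⁺` of finite sums of elementary tensors of positive elements. -/
def simpleCone (A : AOU V) (B : AOU W) : Set (TensorProduct ℝ V W) :=
  {z | ∃ (n : ℕ) (v : Fin n → V) (w : Fin n → W),
    (∀ i, v i ∈ A.pos) ∧ (∀ i, w i ∈ B.pos) ∧ z = ∑ i, v i ⊗ₜ[ℝ] w i}

/-- The projective cone `(V ⊗_π W)⁺`. -/
def projCone (A : AOU V) (B : AOU W) : Set (TensorProduct ℝ V W) :=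
  {z | ∀ ε : ℝ, 0 < ε → z + ε • (A.unit ⊗ₜ[ℝ] B.unit) ∈ simpleCone A B}

/-- The order norm determined by a cone `pos` and order unit `e`. -/
noncomputable def gNorm {X : Type*} [AddCommGroup X] [Module ℝ X]
    (pos : Set X) (e : X) (x : X) : ℝ :=
  sInf {r : ℝ | 0 < r ∧ r • e - x ∈ pos ∧ r • e + x ∈ pos}

/-- `C(K, ℝ)` as a real AOU space: pointwise nonnegative cone and unit the constant
function `1`. -/
noncomputable def ckAOU (K : Type*) [TopologicalSpace K] [CompactSpace K] :
    AOU C(K, ℝ) where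
  pos := {f | ∀ x, 0 ≤ f x}
  unit := 1
  zero_mem := fun _ => le_refl 0
  add_mem := fun f g hf hg x => by simpa using add_nonneg (hf x) (hg x)
  smul_mem := fun r hr f hf x => by simpa using mul_nonneg hr (hf x)
  proper := fun f hf hnf => by
    ext x
    have h1 : f x ≤ 0 := by have := hnf x; simpa using this
    simpa using le_antisymm h1 (hf x)
  exists_orderUnit := fun f =>
    ⟨‖f‖ + 1, by positivity, fun x => by
      have h : f x ≤ ‖f‖ := (abs_le.mp (by simpa using f.norm_coe_le_norm x)).2
      simp only [ContinuousMap.sub_apply, ContinuousMap.smul_apply,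
        ContinuousMap.one_apply, smul_eq_mul, mul_one]
      linarith⟩
  arch := fun f h x => by
    by_contra hneg
    push_neg at hneg
    have h2 := h (-(f x) / 2) (by linarith) x
    simp only [ContinuousMap.add_apply, ContinuousMap.smul_apply,
      ContinuousMap.one_apply, smul_eq_mul, mul_one] at h2
    linarith

namespace AOU

theorem unit_mem (A : AOU V) : A.unit ∈ A.pos := by
  obtain ⟨r, hr, h⟩ := A.exists_orderUnit 0
  have := A.smul_mem (inv_nonneg.2 hr.le) h
  rwa [sub_zero, smul_smul, inv_mul_cancel₀ hr.ne', one_smul] at this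

/-- Every element is dominated in both directions by a multiple of the order unit. -/
theorem exists_orderUnit_abs (A : AOU V) (v : V) :
    ∃ r : ℝ, 0 < r ∧ r • A.unit - v ∈ A.pos ∧ r • A.unit + v ∈ A.pos := by
  obtain ⟨r, hr, h⟩ := A.exists_orderUnit v
  obtain ⟨s, hs, h'⟩ := A.exists_orderUnit (-v)
  refine ⟨r + s, add_pos hr hs, ?_, ?_⟩
  · convert A.add_mem h (A.smul_mem hs.le A.unit_mem) using 1
    module
  · convert A.add_mem h' (A.smul_mem hr.le A.unit_mem) using 1
    module

/-- The convex cone generated by the positive cone and a vector `u`. -/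
def coneInsert (A : AOU V) (u : V) : PointedCone ℝ V where
  carrier := {y | ∃ c : ℝ, 0 ≤ c ∧ ∃ p ∈ A.pos, y = p + c • u}
  smul_mem' := by
    rintro ⟨r, hr⟩ _ ⟨c, hc, p, hp, rfl⟩
    refine ⟨r * c, mul_nonneg hr hc, r • p, A.smul_mem hr hp, ?_⟩
    change r • (p + c • u) = _
    module
  zero_mem' := ⟨0, le_rfl, 0, A.zero_mem, by simp⟩
  add_mem' := by
    rintro _ _ ⟨c, hc, p, hp, rfl⟩ ⟨d, hd, q, hq, rfl⟩
    exact ⟨c + d, add_nonneg hc hd, p + q, A.add_mem hp hq, by module⟩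

/-- The states of an AOU space detect its positive cone. -/
theorem mem_pos_of_forall_state (A : AOU V) {v : V}
    (h : ∀ g : V →ₗ[ℝ] ℝ, IsState A g → 0 ≤ g v) : v ∈ A.pos := by
  by_contra hv
  obtain ⟨ε, hε, hu⟩ : ∃ ε : ℝ, 0 < ε ∧ ε • A.unit + v ∉ A.pos := by
    by_contra! H
    exact hv (A.arch v H)
  set u := ε • A.unit + v with hu_def
  have he : A.unit ≠ 0 := by
    intro he
    obtain ⟨r, -, -, hr⟩ := A.exists_orderUnit_abs v
    rw [he, smul_zero, zero_add] at hr
    exact hv hr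
  have hpos {y : V} (hy : y ∈ A.pos) : y ∈ A.coneInsert (-u) :=
    ⟨0, le_rfl, y, hy, by simp⟩
  obtain ⟨g, hg, hg'⟩ := riesz_extension (A.coneInsert (-u))
    (LinearPMap.mkSpanSingleton A.unit (1 : ℝ) he) (by
      rintro ⟨x, hx⟩ hxs
      obtain ⟨t, rfl⟩ := Submodule.mem_span_singleton.1 hx
      rw [LinearPMap.mkSpanSingleton'_apply]
      by_contra! ht
      simp only [RingHom.id_apply, smul_eq_mul, mul_one] at ht
      obtain ⟨c, hc, p, hp, hcp⟩ := hxs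
      simp only at hcp
      have hcu : c • u ∈ A.pos := by
        convert A.add_mem hp (A.smul_mem (neg_nonneg.2 ht.le) A.unit_mem) using 1
        rw [neg_smul, hcp]
        module
      rcases hc.eq_or_lt with rfl | hc
      · have hmem : -A.unit ∈ A.pos := by
          have := A.smul_mem (inv_nonneg.2 (neg_nonneg.2 ht.le)) hp
          rw [zero_smul, add_zero] at hcp
          rw [← hcp, smul_smul] at this
          convert this using 1
          rw [inv_neg, neg_mul, inv_mul_cancel₀ ht.ne, neg_smul, one_smul]
        exact he (A.proper _ A.unit_mem hmem)
      · refine hu ?_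
        have := A.smul_mem (inv_nonneg.2 hc.le) hcu
        rwa [smul_smul, inv_mul_cancel₀ hc.ne', one_smul] at this) (by
      intro y
      obtain ⟨r, -, -, hr⟩ := A.exists_orderUnit_abs y
      exact ⟨⟨r • A.unit, Submodule.mem_span_singleton.2 ⟨r, rfl⟩⟩, hpos hr⟩)
  have hg1 : g A.unit = 1 := by
    have := hg ⟨A.unit, Submodule.mem_span_singleton_self _⟩
    rw [this]
    exact LinearPMap.mkSpanSingleton_apply ℝ ℝ he 1
  have hgv := h g ⟨hg1, fun y hy => hg' y (hpos hy)⟩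
  have hgu := hg' (-u) ⟨1, zero_le_one, 0, A.zero_mem, by simp⟩
  rw [map_neg, hu_def, map_add, map_smul, hg1, smul_eq_mul, mul_one] at hgu
  linarith

end AOU

section Cones

variable {A : AOU V} {B : AOU W}

theorem tmul_mem_simpleCone {v : V} {w : W} (hv : v ∈ A.pos) (hw : w ∈ B.pos) :
    v ⊗ₜ[ℝ] w ∈ simpleCone A B :=
  ⟨1, fun _ => v, fun _ => w, fun _ => hv, fun _ => hw, by simp⟩

theorem zero_mem_simpleCone : (0 : V ⊗[ℝ] W) ∈ simpleCone A B :=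
  ⟨0, Fin.elim0, Fin.elim0, fun i => i.elim0, fun i => i.elim0, by simp⟩

theorem add_mem_simpleCone {y z : V ⊗[ℝ] W} (hy : y ∈ simpleCone A B)
    (hz : z ∈ simpleCone A B) : y + z ∈ simpleCone A B := by
  obtain ⟨m, v, w, hv, hw, rfl⟩ := hy
  obtain ⟨n, v', w', hv', hw', rfl⟩ := hz
  refine ⟨m + n, Fin.append v v', Fin.append w w', fun i => ?_, fun i => ?_, ?_⟩
  · refine Fin.addCases (fun i => ?_) (fun i => ?_) i <;> simp [hv, hv']
  · refine Fin.addCases (fun i => ?_) (fun i => ?_) i <;> simp [hw, hw']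
  · simp [Fin.sum_univ_add]

theorem sum_mem_simpleCone {ι : Type*} (s : Finset ι) {z : ι → V ⊗[ℝ] W}
    (h : ∀ i ∈ s, z i ∈ simpleCone A B) : ∑ i ∈ s, z i ∈ simpleCone A B :=
  Finset.sum_induction z (· ∈ simpleCone A B) (fun _ _ => add_mem_simpleCone)
    zero_mem_simpleCone h

theorem tensFun_tmul (f : V →ₗ[ℝ] ℝ) (g : W →ₗ[ℝ] ℝ) (v : V) (w : W) :
    tensFun f g (v ⊗ₜ[ℝ] w) = f v * g w := by
  simp [tensFun]

theorem projCone_subset_injCone (A : AOU V) (B : AOU W) : projCone A B ⊆ injCone A B := by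
  intro z hz f g hf hg
  refine le_of_forall_pos_le_add fun ε hε => ?_
  obtain ⟨n, v, w, hv, hw, h⟩ := hz ε hε
  have := congrArg (tensFun f g) h
  simp only [map_add, map_smul, map_sum, tensFun_tmul, hf.1, hg.1, smul_eq_mul, mul_one] at this
  rw [this]
  exact Finset.sum_nonneg fun i _ => mul_nonneg (hf.2 _ (hv i)) (hg.2 _ (hw i))

/-- If `-δe ≤ h ≤ δe` and `-re ≤ w ≤ re` then `h ⊗ w + δr (e ⊗ e)` is a sum of positive
elementary tensors. -/
theorem tmul_add_smul_mem_simpleCone {δ r : ℝ} {h : V} {w : W}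
    (h₁ : δ • A.unit - h ∈ A.pos) (h₂ : δ • A.unit + h ∈ A.pos)
    (w₁ : r • B.unit - w ∈ B.pos) (w₂ : r • B.unit + w ∈ B.pos) :
    h ⊗ₜ[ℝ] w + (δ * r) • (A.unit ⊗ₜ[ℝ] B.unit) ∈ simpleCone A B := by
  have half : (0 : ℝ) ≤ 1 / 2 := by norm_num
  convert add_mem_simpleCone (tmul_mem_simpleCone (A.smul_mem half h₁) w₁)
    (tmul_mem_simpleCone (A.smul_mem half h₂) w₂) using 1
  simp only [TensorProduct.tmul_add, TensorProduct.add_tmul, TensorProduct.tmul_sub,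
    TensorProduct.sub_tmul, ← TensorProduct.smul_tmul', TensorProduct.tmul_smul, smul_add,
    smul_sub]
  module

end Cones

section ContinuousFunctions

variable {K : Type*} [TopologicalSpace K]

/-- Evaluation at a point `x`, regarding an element of `C(K, ℝ) ⊗ W` as a `W`-valued function. -/
noncomputable def evalTensor (x : K) : C(K, ℝ) ⊗[ℝ] W →ₗ[ℝ] W :=
  (TensorProduct.lid ℝ W).toLinearMap ∘ₗ
    LinearMap.rTensor W (ContinuousMap.evalCLM ℝ x : C(K, ℝ) →L[ℝ] ℝ).toLinearMap

@[simp]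
theorem evalTensor_tmul (x : K) (f : C(K, ℝ)) (w : W) :
    evalTensor x (f ⊗ₜ[ℝ] w) = f x • w := by
  simp [evalTensor]

theorem evalTensor_mem_pos [CompactSpace K] {B : AOU W} {z : C(K, ℝ) ⊗[ℝ] W} (hz : z ∈ injCone (ckAOU K) B)
    (x : K) : evalTensor x z ∈ B.pos := by
  refine B.mem_pos_of_forall_state fun g hg => ?_
  have h := hz (ContinuousMap.evalCLM ℝ x : C(K, ℝ) →L[ℝ] ℝ).toLinearMap g
    ⟨by simp [ckAOU], fun v hv => hv x⟩ hg
  have key : tensFun (ContinuousMap.evalCLM ℝ x : C(K, ℝ) →L[ℝ] ℝ).toLinearMap g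
      = g ∘ₗ evalTensor x := by
    ext f w
    simp [tensFun]
  rwa [key] at h

/-- Any element of `C(K, ℝ) ⊗ W` is approximated, in the projective order, by its interpolation
along a sufficiently fine partition of unity. -/
theorem exists_cover_sub_sum_mem_simpleCone [CompactSpace K] (B : AOU W) (z : C(K, ℝ) ⊗[ℝ] W) :
    ∀ ε : ℝ, 0 < ε → ∃ U : K → Set K, (∀ x, IsOpen (U x) ∧ x ∈ U x) ∧
      ∀ (t : Finset K) (ρ : t → C(K, ℝ)), (∀ i y, 0 ≤ ρ i y) → (∀ y, ∑ i, ρ i y = 1) →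
        (∀ i y, ρ i y ≠ 0 → y ∈ U i) →
        z - ∑ i, ρ i ⊗ₜ[ℝ] evalTensor (i : K) z + ε • ((1 : C(K, ℝ)) ⊗ₜ[ℝ] B.unit)
          ∈ simpleCone (ckAOU K) B := by
  induction z with
  | zero =>
    refine fun ε hε => ⟨fun _ => Set.univ, fun x => ⟨isOpen_univ, trivial⟩, ?_⟩
    intro t ρ _ _ _
    simp only [map_zero, TensorProduct.tmul_zero, Finset.sum_const_zero, sub_zero, zero_add,
      TensorProduct.smul_tmul']
    exact tmul_mem_simpleCone ((ckAOU K).smul_mem hε.le (ckAOU K).unit_mem) B.unit_mem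
  | add z₁ z₂ h₁ h₂ =>
    intro ε hε
    obtain ⟨U₁, hU₁, H₁⟩ := h₁ (ε / 2) (half_pos hε)
    obtain ⟨U₂, hU₂, H₂⟩ := h₂ (ε / 2) (half_pos hε)
    refine ⟨fun x => U₁ x ∩ U₂ x, fun x => ⟨(hU₁ x).1.inter (hU₂ x).1, (hU₁ x).2, (hU₂ x).2⟩, ?_⟩
    intro t ρ hρ hsum hsub
    convert add_mem_simpleCone (H₁ t ρ hρ hsum fun i y hy => (hsub i y hy).1)
      (H₂ t ρ hρ hsum fun i y hy => (hsub i y hy).2) using 1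
    simp only [map_add, TensorProduct.tmul_add, Finset.sum_add_distrib]
    module
  | tmul f w =>
    intro ε hε
    obtain ⟨r, hr, hw₁, hw₂⟩ := B.exists_orderUnit_abs w
    have hδ : 0 < ε / r := div_pos hε hr
    refine ⟨fun x => f ⁻¹' Metric.ball (f x) (ε / r),
      fun x => ⟨Metric.isOpen_ball.preimage f.continuous, Metric.mem_ball_self hδ⟩, ?_⟩
    intro t ρ hρ hsum hsub
    have hbound (y : K) : |f y - ∑ i : t, ρ i y * f i| ≤ ε / r := by
      have : f y - ∑ i : t, ρ i y * f i = ∑ i, ρ i y * (f y - f i) := by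
        simp only [mul_sub, Finset.sum_sub_distrib, ← Finset.sum_mul, hsum, one_mul]
      rw [this]
      calc |∑ i, ρ i y * (f y - f i)| ≤ ∑ i, |ρ i y * (f y - f i)| :=
            Finset.abs_sum_le_sum_abs _ _
        _ ≤ ∑ i, ρ i y * (ε / r) := by
            refine Finset.sum_le_sum fun i _ => ?_
            rw [abs_mul, abs_of_nonneg (hρ i y)]
            by_cases h0 : ρ i y = 0
            · simp [h0]
            · have := hsub i y h0
              rw [Set.mem_preimage, Metric.mem_ball, Real.dist_eq] at this
              exact mul_le_mul_of_nonneg_left this.le (hρ i y)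
        _ = ε / r := by rw [← Finset.sum_mul, hsum, one_mul]
    convert tmul_add_smul_mem_simpleCone (A := ckAOU K) (δ := ε / r)
      (h := f - ∑ i : t, f (i : K) • ρ i) (fun y => ?_) (fun y => ?_) hw₁ hw₂ using 2
    · simp only [evalTensor_tmul, TensorProduct.sub_tmul, TensorProduct.sum_tmul,
        TensorProduct.tmul_smul, TensorProduct.smul_tmul']
    · rw [div_mul_cancel₀ _ hr.ne']
      rfl
    all_goals
      have := abs_le.1 (hbound y)
      simp only [ckAOU, ContinuousMap.sub_apply, ContinuousMap.add_apply, ContinuousMap.smul_apply,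
        ContinuousMap.one_apply, ContinuousMap.sum_apply, smul_eq_mul, mul_one,
        mul_comm (f _) (ρ _ y)]
      linarith

/-- An open cover of a compact Hausdorff space by neighbourhoods of points admits a subordinate
finite partition of unity. -/
theorem exists_finite_partition_of_unity [CompactSpace K] [T2Space K] (U : K → Set K)
    (hU : ∀ x, IsOpen (U x) ∧ x ∈ U x) :
    ∃ (t : Finset K) (ρ : t → C(K, ℝ)), (∀ i y, 0 ≤ ρ i y) ∧ (∀ y, ∑ i, ρ i y = 1) ∧
      ∀ i y, ρ i y ≠ 0 → y ∈ U i := by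
  obtain ⟨t, ht⟩ := isCompact_univ.elim_finite_subcover U (fun x => (hU x).1)
    fun x _ => Set.mem_iUnion.2 ⟨x, (hU x).2⟩
  obtain ⟨p, hp⟩ := PartitionOfUnity.exists_isSubordinate isClosed_univ (fun i : t => U i)
    (fun i => (hU i).1) (by simpa [Set.iUnion_subtype] using ht)
  refine ⟨t, fun i => p i, fun i y => p.nonneg i y, fun y => ?_, fun i y hy => ?_⟩
  · rw [← finsum_eq_sum_of_fintype]
    exact p.sum_eq_one (Set.mem_univ y)
  · exact hp i (subset_tsupport _ hy)

end ContinuousFunctions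

/-- for a nonempty compact Hausdorff space `K`, the real AOU space
`C(K, ℝ)` is nuclear. -/
theorem continuous_functions_nuclear (K : Type*) [TopologicalSpace K] [CompactSpace K]
    [T2Space K] [Nonempty K]
    {W : Type*} [AddCommGroup W] [Module ℝ W] (B : AOU W) :
    injCone (ckAOU K) B = projCone (ckAOU K) B := by
  refine Set.Subset.antisymm (fun z hz ε hε => ?_) (projCone_subset_injCone _ _)
  obtain ⟨U, hU, H⟩ := exists_cover_sub_sum_mem_simpleCone B z ε hε
  obtain ⟨t, ρ, hρ, hsum, hsub⟩ := exists_finite_partition_of_unity U hU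
  have hpos := sum_mem_simpleCone (A := ckAOU K) (B := B) Finset.univ
    fun i _ => tmul_mem_simpleCone (hρ i) (evalTensor_mem_pos hz (i : K))
  convert add_mem_simpleCone (H t ρ hρ hsum hsub) hpos using 1
  simp only [ckAOU]
  abel
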